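/- arXiv:2512.24915 — 2 statements merged into one kernel-verified Lean document; each statement's English description precedes it below -/
import Mathlib

section
/- Let L > 0 and a, b, c > 0 be real numbers and let p : [0,L] → ℝ be continuous, nonnegative, and not identically zero. Suppose there exists a constant λ > 0 such that p(x) ≤ [λ·π⁴/L⁴ + a·λ·π²/L² + 2·b·λ²·π/L]·sin(π·x/L) + 2·λ·c·L/π for all x ∈ (0,L), such that c + b·λ·π²/L² ≤ (4·(a + 2·b·λ·L/π)/L³)·σ(√(a + 2·b·λ·L/π)·L), and such that λ·(L³/4)·(2·b/π + b·π²/4) ≤ 1. Then problem (4.1),(1.2) has exactly one solution w satisfying 0 ≤ w(x) ≤ λ·sin(π·x/L) and 0 ≥ w''(x) ≥ −λ·(π²/L²)·sin(π·x/L) on [0,L], and this solution is positive on (0,L). -/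
open Real

/-- The auxiliary function `σ(x) = 3x³ / (6x cosh x + 6x − 12 sinh x − x³)`. -/
noncomputable def sigmaFun (x : ℝ) : ℝ :=
  3 * x ^ 3 / (6 * x * Real.cosh x + 6 * x - 12 * Real.sinh x - x ^ 3)

/-- `w` is a (classical, C⁴ on `[0,L]`) solution of problem (4.1),(1.2):
`w'''' − (a + b∫₀ᴸ w) w'' + c∫₀ᴸ w = p` on `(0,L)` with Navier boundary
conditions `w(0) = w(L) = w''(0) = w''(L) = 0`. -/
def IsMelanSolution (L a b c : ℝ) (p w : ℝ → ℝ) : Prop :=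
  ContDiffOn ℝ 4 w (Set.Icc 0 L) ∧
  (∀ x ∈ Set.Ioo (0:ℝ) L,
    iteratedDerivWithin 4 w (Set.Icc 0 L) x
      - (a + b * ∫ t in (0:ℝ)..L, w t) * iteratedDerivWithin 2 w (Set.Icc 0 L) x
      + c * ∫ t in (0:ℝ)..L, w t = p x) ∧
  w 0 = 0 ∧ w L = 0 ∧
  iteratedDerivWithin 2 w (Set.Icc 0 L) 0 = 0 ∧
  iteratedDerivWithin 2 w (Set.Icc 0 L) L = 0

/-- `α` is a lower solution of problem (4.1),(1.2). -/
def IsMelanLowerSolution (L a b c : ℝ) (p α : ℝ → ℝ) : Prop :=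
  ContDiffOn ℝ 4 α (Set.Icc 0 L) ∧
  (∀ x ∈ Set.Ioo (0:ℝ) L,
    iteratedDerivWithin 4 α (Set.Icc 0 L) x
      - (a + b * ∫ t in (0:ℝ)..L, α t) * iteratedDerivWithin 2 α (Set.Icc 0 L) x
      + c * ∫ t in (0:ℝ)..L, α t ≤ p x) ∧
  α 0 = 0 ∧ α L = 0 ∧
  iteratedDerivWithin 2 α (Set.Icc 0 L) 0 = 0 ∧
  iteratedDerivWithin 2 α (Set.Icc 0 L) L = 0

/-- `β` is an upper solution of problem (4.1),(1.2). -/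
def IsMelanUpperSolution (L a b c : ℝ) (p β : ℝ → ℝ) : Prop :=
  ContDiffOn ℝ 4 β (Set.Icc 0 L) ∧
  (∀ x ∈ Set.Ioo (0:ℝ) L,
    p x ≤ iteratedDerivWithin 4 β (Set.Icc 0 L) x
      - (a + b * ∫ t in (0:ℝ)..L, β t) * iteratedDerivWithin 2 β (Set.Icc 0 L) x
      + c * ∫ t in (0:ℝ)..L, β t) ∧
  β 0 = 0 ∧ β L = 0 ∧
  iteratedDerivWithin 2 β (Set.Icc 0 L) 0 = 0 ∧
  iteratedDerivWithin 2 β (Set.Icc 0 L) L = 0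

open Set Filter Topology MeasureTheory

section Hyperbolic

theorem nonneg_of_hasDerivAt_nonneg {f f' : ℝ → ℝ} (h0 : f 0 = 0)
    (hf : ∀ x, HasDerivAt f (f' x) x) (hf' : ∀ x, 0 ≤ x → 0 ≤ f' x) {x : ℝ} (hx : 0 ≤ x) :
    0 ≤ f x := by
  have hmono : MonotoneOn f (Ici 0) := by
    refine monotoneOn_of_deriv_nonneg (convex_Ici 0)
      (fun y _ => (hf y).continuousAt.continuousWithinAt)
      (fun y _ => (hf y).differentiableAt.differentiableWithinAt) fun y hy => ?_
    rw [(hf y).deriv]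
    exact hf' y (interior_subset hy)
  simpa [h0] using hmono self_mem_Ici hx hx

theorem pos_of_hasDerivAt_pos {f f' : ℝ → ℝ} (h0 : f 0 = 0)
    (hf : ∀ x, HasDerivAt f (f' x) x) (hf' : ∀ x, 0 < x → 0 < f' x) {x : ℝ} (hx : 0 < x) :
    0 < f x := by
  have hmono : StrictMonoOn f (Ici 0) := by
    refine strictMonoOn_of_deriv_pos (convex_Ici 0)
      (fun y _ => (hf y).continuousAt.continuousWithinAt) fun y hy => ?_
    rw [(hf y).deriv]
    exact hf' y (by simpa using hy)
  simpa [h0] using hmono self_mem_Ici hx.le hx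

theorem sinh_lt_mul_cosh {x : ℝ} (hx : 0 < x) : sinh x < x * cosh x := by
  have h := pos_of_hasDerivAt_pos (f := fun x => x * cosh x - sinh x) (f' := fun x => x * sinh x)
    (by simp)
    (fun y => by
      convert! ((hasDerivAt_id y).fun_mul (hasDerivAt_cosh y)).fun_sub (hasDerivAt_sinh y) using 1
      simp)
    (fun y hy => mul_pos hy (sinh_pos_iff.2 hy)) hx
  linarith

theorem two_mul_cosh_sub_one_le_mul_sinh {x : ℝ} (hx : 0 ≤ x) :
    2 * (cosh x - 1) ≤ x * sinh x := by
  have h := nonneg_of_hasDerivAt_nonneg (f := fun x => x * sinh x - 2 * (cosh x - 1))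
    (f' := fun x => x * cosh x - sinh x) (by simp)
    (fun y => by
      convert! ((hasDerivAt_id y).fun_mul (hasDerivAt_sinh y)).fun_sub
        (((hasDerivAt_cosh y).sub_const 1).const_mul 2) using 1
      simp only [id]
      ring)
    (fun y hy => by
      rcases hy.eq_or_lt with rfl | hy
      · simp
      · linarith [sinh_lt_mul_cosh hy]) hx
  linarith

/-- The denominator of `sigmaFun`. -/
noncomputable def sigmaDen (x : ℝ) : ℝ :=
  6 * x * cosh x + 6 * x - 12 * sinh x - x ^ 3

theorem hasDerivAt_sigmaDen (x : ℝ) :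
    HasDerivAt sigmaDen (6 * x * sinh x - 6 * cosh x + 6 - 3 * x ^ 2) x := by
  convert! (((((hasDerivAt_id x).const_mul 6).fun_mul (hasDerivAt_cosh x)).fun_add
    ((hasDerivAt_id x).const_mul 6)).fun_sub ((hasDerivAt_sinh x).const_mul 12)).fun_sub
    (hasDerivAt_pow 3 x) using 1
  simp only [id]
  push_cast
  ring

theorem five_mul_sigmaDen_le {x : ℝ} (hx : 0 ≤ x) :
    5 * sigmaDen x ≤ x * (6 * x * sinh x - 6 * cosh x + 6 - 3 * x ^ 2) := by
  have h1 : ∀ y : ℝ, 0 ≤ y →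
      0 ≤ 6 * y ^ 2 * cosh y - 24 * y * sinh y + 24 * cosh y - 24 + 6 * y ^ 2 := fun y hy =>
    nonneg_of_hasDerivAt_nonneg
      (f := fun y => 6 * y ^ 2 * cosh y - 24 * y * sinh y + 24 * cosh y - 24 + 6 * y ^ 2)
      (f' := fun y => 6 * y * (y * sinh y - 2 * (cosh y - 1))) (by simp)
      (fun y => by
        convert! ((((((hasDerivAt_pow 2 y).const_mul 6).fun_mul (hasDerivAt_cosh y)).fun_sub
          (((hasDerivAt_id y).const_mul 24).fun_mul (hasDerivAt_sinh y))).fun_add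
          ((hasDerivAt_cosh y).const_mul 24)).sub_const 24).fun_add
          ((hasDerivAt_pow 2 y).const_mul 6) using 1
        simp only [id]
        push_cast
        ring)
      (fun y hy => by
        have := two_mul_cosh_sub_one_le_mul_sinh hy
        exact mul_nonneg (by positivity) (by linarith)) hy
  have h2 := nonneg_of_hasDerivAt_nonneg
    (f := fun y => 6 * y ^ 2 * sinh y - 36 * y * cosh y + 60 * sinh y - 24 * y + 2 * y ^ 3)
    (f' := fun y => 6 * y ^ 2 * cosh y - 24 * y * sinh y + 24 * cosh y - 24 + 6 * y ^ 2) (by simp)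
    (fun y => by
      convert! ((((((hasDerivAt_pow 2 y).const_mul 6).fun_mul (hasDerivAt_sinh y)).fun_sub
        (((hasDerivAt_id y).const_mul 36).fun_mul (hasDerivAt_cosh y))).fun_add
        ((hasDerivAt_sinh y).const_mul 60)).fun_sub ((hasDerivAt_id y).const_mul 24)).fun_add
        ((hasDerivAt_pow 3 y).const_mul 2) using 1
      simp only [id]
      push_cast
      ring) h1 hx
  unfold sigmaDen
  linarith

theorem sigmaDen_div_pow_five_le {x y : ℝ} (hx : 0 < x) (hxy : x ≤ y) :
    sigmaDen x / x ^ 5 ≤ sigmaDen y / y ^ 5 := by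
  have hd : ∀ z : ℝ, 0 < z → HasDerivAt (fun z => sigmaDen z / z ^ 5)
      (((6 * z * sinh z - 6 * cosh z + 6 - 3 * z ^ 2) * z ^ 5 - sigmaDen z * (5 * z ^ 4))
        / (z ^ 5) ^ 2) z := fun z hz => by
    simpa using (hasDerivAt_sigmaDen z).fun_div (hasDerivAt_pow 5 z) (by positivity)
  have hmono : MonotoneOn (fun z => sigmaDen z / z ^ 5) (Ioi 0) := by
    refine monotoneOn_of_deriv_nonneg (convex_Ioi 0)
      (fun z hz => (hd z hz).continuousAt.continuousWithinAt)
      (fun z hz => (hd z (interior_subset hz)).differentiableAt.differentiableWithinAt)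
      fun z hz => ?_
    have hz : 0 < z := interior_subset hz
    rw [(hd z hz).deriv]
    refine div_nonneg ?_ (by positivity)
    have := mul_le_mul_of_nonneg_left (five_mul_sigmaDen_le hz.le) (by positivity : 0 ≤ z ^ 4)
    linarith
  exact hmono hx (hx.trans_le hxy) hxy

end Hyperbolic

section MaximumPrinciple

theorem IsLocalMax.deriv2_nonpos {g g₁ : ℝ → ℝ} {g₂ x : ℝ} (hx : IsLocalMax g x)
    (h₁ : ∀ᶠ y in 𝓝 x, HasDerivAt g (g₁ y) y) (h₂ : HasDerivAt g₁ g₂ x) : g₂ ≤ 0 := by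
  by_contra! hpos
  have heq : deriv g =ᶠ[𝓝 x] g₁ := h₁.mono fun y hy => hy.deriv
  have hdd : deriv (deriv g) x = g₂ := heq.deriv_eq.trans h₂.deriv
  have hmin : IsLocalMin g x :=
    isLocalMin_of_deriv_deriv_pos (by rwa [hdd]) hx.deriv_eq_zero h₁.self_of_nhds.continuousAt
  have hconst : g =ᶠ[𝓝 x] fun _ => g x := by
    filter_upwards [hx, hmin] with y h h' using le_antisymm h h'
  have := hconst.deriv.deriv_eq
  simp [hdd] at this
  linarith

theorem nonpos_of_mul_le_deriv2 {L m : ℝ} (hm : 0 ≤ m) {f f₁ f₂ : ℝ → ℝ}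
    (hc : ContinuousOn f (Icc 0 L)) (h₁ : ∀ x ∈ Ioo 0 L, HasDerivAt f (f₁ x) x)
    (h₂ : ∀ x ∈ Ioo 0 L, HasDerivAt f₁ (f₂ x) x) (h : ∀ x ∈ Ioo 0 L, m * f x ≤ f₂ x)
    (h0 : f 0 ≤ 0) (hL : f L ≤ 0) : ∀ x ∈ Icc 0 L, f x ≤ 0 := by
  intro x₀ hx₀
  by_contra! hpos
  obtain ⟨ε, hε, hε'⟩ : ∃ ε > 0, ε * (x₀ * (L - x₀)) < f x₀ := by
    have hq : 0 ≤ x₀ * (L - x₀) := mul_nonneg hx₀.1 (by linarith [hx₀.2])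
    refine ⟨f x₀ / (x₀ * (L - x₀) + 1), by positivity, ?_⟩
    rw [div_mul_eq_mul_div, div_lt_iff₀ (by positivity)]
    linarith
  set g : ℝ → ℝ := fun x => f x - ε * (x * (L - x)) with hg
  obtain ⟨x₁, hx₁, hmax⟩ := isCompact_Icc.exists_isMaxOn ⟨x₀, hx₀⟩
    (hc.sub (by fun_prop : ContinuousOn (fun x => ε * (x * (L - x))) (Icc 0 L)))
  have hgpos₀ : 0 < g x₀ := sub_pos.2 hε'
  have hgpos : 0 < g x₁ := hgpos₀.trans_le (hmax hx₀)
  have hIoo : x₁ ∈ Ioo 0 L := by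
    refine ⟨lt_of_le_of_ne hx₁.1 fun h => ?_, lt_of_le_of_ne hx₁.2 fun h => ?_⟩
    · subst h; simp [hg] at hgpos; linarith
    · subst h; simp [hg] at hgpos; linarith
  have hd : ∀ x ∈ Ioo 0 L, HasDerivAt g (f₁ x - ε * (L - 2 * x)) x := fun x hx => by
    convert! (h₁ x hx).fun_sub
      (((hasDerivAt_id x).fun_mul ((hasDerivAt_id x).const_sub L)).const_mul ε) using 1
    simp only [id]
    ring
  have hd₂ : HasDerivAt (fun x => f₁ x - ε * (L - 2 * x)) (f₂ x₁ + 2 * ε) x₁ := by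
    convert! (h₂ x₁ hIoo).fun_sub
      ((((hasDerivAt_id x₁).const_mul 2).const_sub L).const_mul ε) using 1
    ring
  have hle := IsLocalMax.deriv2_nonpos (hmax.isLocalMax (Icc_mem_nhds hIoo.1 hIoo.2))
    (eventually_of_mem (Ioo_mem_nhds hIoo.1 hIoo.2) hd) hd₂
  have hfpos : 0 ≤ f x₁ := by
    have : 0 ≤ ε * (x₁ * (L - x₁)) :=
      mul_nonneg hε.le (mul_nonneg hx₁.1 (by linarith [hx₁.2]))
    simp only [hg] at hgpos
    linarith
  linarith [h x₁ hIoo, mul_nonneg hm hfpos]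

end MaximumPrinciple

section LinearProblem

theorem integral_mul_deriv2_eq {L : ℝ} {h h₁ h₂ v v₁ v₂ : ℝ → ℝ}
    (hh : ∀ x, HasDerivAt h (h₁ x) x) (hh₁ : ∀ x, HasDerivAt h₁ (h₂ x) x)
    (hv : ∀ x, HasDerivAt v (v₁ x) x) (hv₁ : ∀ x, HasDerivAt v₁ (v₂ x) x)
    (ch₂ : Continuous h₂) (cv₂ : Continuous v₂)
    (h0 : h 0 = 0) (hL : h L = 0) (v0 : v 0 = 0) (vL : v L = 0) :
    ∫ x in (0 : ℝ)..L, h x * v₂ x = ∫ x in (0 : ℝ)..L, h₂ x * v x := by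
  have ch : Continuous h := continuous_iff_continuousAt.2 fun x => (hh x).continuousAt
  have cv : Continuous v := continuous_iff_continuousAt.2 fun x => (hv x).continuousAt
  have hd : ∀ x, HasDerivAt (fun x => h x * v₁ x - h₁ x * v x) (h x * v₂ x - h₂ x * v x) x :=
    fun x => by
      convert! ((hh x).fun_mul (hv₁ x)).fun_sub ((hh₁ x).fun_mul (hv x)) using 1
      ring
  have hFTC := intervalIntegral.integral_eq_sub_of_hasDerivAt (a := 0) (b := L)
    (fun x _ => hd x)
    ((by fun_prop : Continuous fun x => h x * v₂ x - h₂ x * v x).intervalIntegrable _ _)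
  rw [intervalIntegral.integral_sub
    ((by fun_prop : Continuous fun x => h x * v₂ x).intervalIntegrable _ _)
    ((by fun_prop : Continuous fun x => h₂ x * v x).intervalIntegrable _ _)] at hFTC
  simp only [h0, hL, v0, vL] at hFTC
  linarith

theorem hasDerivAt_mul_sub_half (L x : ℝ) :
    HasDerivAt (fun x => x * (L - x) / 2) (L / 2 - x) x := by
  convert! ((hasDerivAt_id x).fun_mul ((hasDerivAt_id x).const_sub L)).div_const 2 using 1
  simp only [id]
  ring

theorem integral_eq_integral_mul_of_deriv2 {L : ℝ} {w w₁ v : ℝ → ℝ}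
    (hw : ∀ x, HasDerivAt w (w₁ x) x) (hw₁ : ∀ x, HasDerivAt w₁ (-v x) x) (cv : Continuous v)
    (w0 : w 0 = 0) (wL : w L = 0) :
    ∫ x in (0 : ℝ)..L, w x = ∫ x in (0 : ℝ)..L, x * (L - x) / 2 * v x := by
  have h := integral_mul_deriv2_eq (L := L) (hasDerivAt_mul_sub_half L)
    (fun x => (hasDerivAt_id x).const_sub (L / 2)) hw hw₁ (by fun_prop) (by fun_prop)
    (by simp) (by simp) w0 wL
  simp only [mul_neg, neg_mul, one_mul, intervalIntegral.integral_neg] at h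
  linarith

theorem exists_deriv2_eq_neg {L : ℝ} (hL : 0 < L) {v : ℝ → ℝ} (cv : Continuous v) :
    ∃ w w₁ : ℝ → ℝ, (∀ x, HasDerivAt w (w₁ x) x) ∧ (∀ x, HasDerivAt w₁ (-v x) x) ∧
      w 0 = 0 ∧ w L = 0 := by
  have hV : ∀ x, HasDerivAt (fun x => ∫ t in (0 : ℝ)..x, v t) (v x) x := fun x =>
    (cv.integral_hasStrictDerivAt 0 x).hasDerivAt
  have cV : Continuous fun x => ∫ t in (0 : ℝ)..x, v t :=
    continuous_iff_continuousAt.2 fun x => (hV x).continuousAt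
  have hW : ∀ x, HasDerivAt (fun x => ∫ s in (0 : ℝ)..x, ∫ t in (0 : ℝ)..s, v t)
      (∫ t in (0 : ℝ)..x, v t) x := fun x => (cV.integral_hasStrictDerivAt 0 x).hasDerivAt
  set k := (∫ s in (0 : ℝ)..L, ∫ t in (0 : ℝ)..s, v t) / L with hk
  refine ⟨fun x => k * x - ∫ s in (0 : ℝ)..x, ∫ t in (0 : ℝ)..s, v t,
    fun x => k - ∫ t in (0 : ℝ)..x, v t, fun x => ?_, fun x => (hV x).const_sub k, by simp, ?_⟩
  · simpa using ((hasDerivAt_id x).const_mul k).fun_sub (hW x)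
  · simp only [hk]
    field_simp
    simp

theorem hasDerivAt_sinh_mul (μ x : ℝ) :
    HasDerivAt (fun x => sinh (μ * x)) (μ * cosh (μ * x)) x := by
  simpa [mul_comm] using ((hasDerivAt_id x).const_mul μ).sinh

theorem hasDerivAt_cosh_mul (μ x : ℝ) :
    HasDerivAt (fun x => cosh (μ * x)) (μ * sinh (μ * x)) x := by
  simpa [mul_comm] using ((hasDerivAt_id x).const_mul μ).cosh

theorem exists_deriv2_eq_mul_sub {L μ : ℝ} (hL : 0 < L) (hμ : 0 < μ) {g : ℝ → ℝ}
    (cg : Continuous g) :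
    ∃ v v₁ : ℝ → ℝ, (∀ x, HasDerivAt v (v₁ x) x) ∧
      (∀ x, HasDerivAt v₁ (μ ^ 2 * v x - g x) x) ∧ v 0 = 0 ∧ v L = 0 := by
  set A : ℝ → ℝ := fun x => ∫ s in (0 : ℝ)..x, cosh (μ * s) * g s with hA
  set B : ℝ → ℝ := fun x => ∫ s in (0 : ℝ)..x, sinh (μ * s) * g s with hB
  have dA : ∀ x, HasDerivAt A (cosh (μ * x) * g x) x := fun x =>
    ((by fun_prop : Continuous fun s => cosh (μ * s) * g s).integral_hasStrictDerivAt
      0 x).hasDerivAt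
  have dB : ∀ x, HasDerivAt B (sinh (μ * x) * g x) x := fun x =>
    ((by fun_prop : Continuous fun s => sinh (μ * s) * g s).integral_hasStrictDerivAt
      0 x).hasDerivAt
  have hs : 0 < sinh (μ * L) := sinh_pos_iff.2 (by positivity)
  set k := (sinh (μ * L) * A L - cosh (μ * L) * B L) / μ / sinh (μ * L) with hk
  refine ⟨fun x => k * sinh (μ * x) - (sinh (μ * x) * A x - cosh (μ * x) * B x) / μ,
    fun x => k * (μ * cosh (μ * x)) - (cosh (μ * x) * A x - sinh (μ * x) * B x),
    fun x => ?_, fun x => ?_, by simp [hB], ?_⟩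
  · convert! ((hasDerivAt_sinh_mul μ x).const_mul k).fun_sub
      ((((hasDerivAt_sinh_mul μ x).fun_mul (dA x)).fun_sub
        ((hasDerivAt_cosh_mul μ x).fun_mul (dB x))).div_const μ) using 1
    field_simp
    ring
  · convert! (((hasDerivAt_cosh_mul μ x).const_mul μ).const_mul k).fun_sub
      (((hasDerivAt_cosh_mul μ x).fun_mul (dA x)).fun_sub
        ((hasDerivAt_sinh_mul μ x).fun_mul (dB x))) using 1
    have := cosh_sq (μ * x)
    field_simp
    linear_combination (g x) * this
  · simp only [hk]
    field_simp
    ring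

/-- Green's representation for `-u'' + μ² u = f` with Dirichlet conditions. -/
theorem mul_sinh_eq_of_deriv2 {L μ : ℝ} {u u₁ f : ℝ → ℝ} (cf : Continuous f)
    (hu : ∀ x, HasDerivAt u (u₁ x) x) (hu₁ : ∀ x, HasDerivAt u₁ (μ ^ 2 * u x - f x) x)
    (u0 : u 0 = 0) (uL : u L = 0) (x : ℝ) :
    u x * (μ * sinh (μ * L)) = sinh (μ * (L - x)) * (∫ s in (0 : ℝ)..x, sinh (μ * s) * f s)
      + sinh (μ * x) * ∫ s in x..L, sinh (μ * (L - s)) * f s := by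
  have hr : ∀ s, HasDerivAt (fun s => sinh (μ * (L - s))) (-(μ * cosh (μ * (L - s)))) s :=
    fun s => by
      simpa [mul_comm] using (((hasDerivAt_id s).const_sub L).const_mul μ).sinh
  have hr' : ∀ s, HasDerivAt (fun s => cosh (μ * (L - s))) (-(μ * sinh (μ * (L - s)))) s :=
    fun s => by
      simpa [mul_comm] using (((hasDerivAt_id s).const_sub L).const_mul μ).cosh
  have I₁ := intervalIntegral.integral_eq_sub_of_hasDerivAt (a := 0) (b := x)
    (f := fun s => μ * cosh (μ * s) * u s - sinh (μ * s) * u₁ s)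
    (f' := fun s => sinh (μ * s) * f s)
    (fun s _ => by
      convert! (((hasDerivAt_cosh_mul μ s).const_mul μ).fun_mul (hu s)).fun_sub
        ((hasDerivAt_sinh_mul μ s).fun_mul (hu₁ s)) using 1
      ring)
    ((by fun_prop : Continuous fun s => sinh (μ * s) * f s).intervalIntegrable _ _)
  have I₂ := intervalIntegral.integral_eq_sub_of_hasDerivAt (a := x) (b := L)
    (f := fun s => -(μ * cosh (μ * (L - s)) * u s) - sinh (μ * (L - s)) * u₁ s)
    (f' := fun s => sinh (μ * (L - s)) * f s)
    (fun s _ => by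
      convert! ((((hr' s).const_mul μ).fun_mul (hu s)).fun_neg).fun_sub
        ((hr s).fun_mul (hu₁ s)) using 1
      ring)
    ((by fun_prop : Continuous fun s => sinh (μ * (L - s)) * f s).intervalIntegrable _ _)
  rw [I₁, I₂]
  have hadd : sinh (μ * L)
      = sinh (μ * (L - x)) * cosh (μ * x) + cosh (μ * (L - x)) * sinh (μ * x) := by
    rw [← sinh_add]
    ring_nf
  simp only [u0, uL, hadd, mul_zero, sinh_zero, sub_self]
  ring

end LinearProblem

section Positivity

/-- Up to the factor `μ² cosh (μ L / 2)`, the Dirichlet solution of `-e'' + μ² e = 1`. -/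
noncomputable def constProfile (L μ x : ℝ) : ℝ :=
  cosh (μ * L / 2) - cosh (μ * (x - L / 2))

/-- Up to the factor `μ⁴ cosh (μ L / 2)`, the Dirichlet solution of
`-h'' + μ² h = x (L - x) / 2`. -/
noncomputable def quadProfile (L μ x : ℝ) : ℝ :=
  μ ^ 2 * cosh (μ * L / 2) * (x * (L - x) / 2) - constProfile L μ x

theorem hasDerivAt_constProfile (L μ x : ℝ) :
    HasDerivAt (constProfile L μ) (-(μ * sinh (μ * (x - L / 2)))) x := by
  convert! ((((hasDerivAt_id x).sub_const (L / 2)).const_mul μ).cosh).const_sub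
    (cosh (μ * L / 2)) using 1
  simp only [id]
  ring

theorem hasDerivAt_deriv_constProfile (L μ x : ℝ) :
    HasDerivAt (fun x => -(μ * sinh (μ * (x - L / 2))))
      (μ ^ 2 * constProfile L μ x - μ ^ 2 * cosh (μ * L / 2)) x := by
  convert! (((((hasDerivAt_id x).sub_const (L / 2)).const_mul μ).sinh).const_mul μ).fun_neg using 1
  simp only [constProfile, id]
  ring

theorem continuous_constProfile (L μ : ℝ) : Continuous (constProfile L μ) := by
  unfold constProfile
  fun_prop

theorem continuous_quadProfile (L μ : ℝ) : Continuous (quadProfile L μ) := by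
  unfold quadProfile constProfile
  fun_prop

theorem constProfile_zero (L μ : ℝ) : constProfile L μ 0 = 0 := by
  rw [constProfile, ← cosh_neg (μ * (0 - L / 2)), sub_eq_zero]
  ring_nf

theorem constProfile_right (L μ : ℝ) : constProfile L μ L = 0 := by
  rw [constProfile, sub_eq_zero]
  ring_nf

theorem constProfile_sub (L μ x : ℝ) : constProfile L μ (L - x) = constProfile L μ x := by
  unfold constProfile
  rw [← cosh_neg (μ * (L - x - L / 2))]
  ring_nf

theorem quadProfile_sub (L μ x : ℝ) : quadProfile L μ (L - x) = quadProfile L μ x := by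
  unfold quadProfile
  rw [constProfile_sub]
  ring

theorem constProfile_eq (L μ x : ℝ) : constProfile L μ x =
    cosh (μ * L / 2) - cosh (μ * L / 2) * cosh (μ * x) + sinh (μ * L / 2) * sinh (μ * x) := by
  rw [constProfile, show μ * (x - L / 2) = μ * x - μ * L / 2 by ring, cosh_sub]
  ring

theorem constProfile_nonneg {L μ x : ℝ} (hμ : 0 < μ) (hx : x ∈ Icc 0 L) :
    0 ≤ constProfile L μ x := by
  have hL : 0 ≤ L := hx.1.trans hx.2
  rw [constProfile, sub_nonneg, cosh_le_cosh, abs_mul, abs_of_pos hμ,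
    abs_of_nonneg (by positivity : 0 ≤ μ * L / 2), mul_div_assoc]
  refine mul_le_mul_of_nonneg_left (abs_le.2 ⟨?_, ?_⟩) hμ.le <;> linarith [hx.1, hx.2]

theorem constProfile_le (L μ x : ℝ) :
    constProfile L μ x ≤ sinh (μ * L / 2) * sinh (μ * x) := by
  rw [constProfile_eq]
  nlinarith [one_le_cosh (μ * x), cosh_pos (μ * L / 2)]

theorem quadProfile_le {L μ x : ℝ} (hμ : 0 < μ) (hx : x ∈ Icc 0 L) :
    quadProfile L μ x ≤
      (μ * L / 2 * cosh (μ * L / 2) - sinh (μ * L / 2)) * sinh (μ * x) := by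
  have hy : 0 ≤ μ * x := mul_nonneg hμ.le hx.1
  have h₁ := two_mul_cosh_sub_one_le_mul_sinh hy
  have h₂ := self_le_sinh_iff.2 hy
  have h₃ : μ * x ≤ μ * L := mul_le_mul_of_nonneg_left hx.2 hμ.le
  have h₄ : 0 ≤ μ * L / 2 * (sinh (μ * x) - μ * x) + (μ * x) ^ 2 / 2 - (cosh (μ * x) - 1) := by
    nlinarith
  have h₅ := mul_nonneg (cosh_pos (μ * L / 2)).le h₄
  rw [quadProfile, constProfile_eq]
  linarith

/-- Self-adjointness of the Dirichlet problem, tested against `quadProfile`. -/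
theorem integral_quadProfile_mul {L μ : ℝ} {v v₁ g : ℝ → ℝ} (cg : Continuous g)
    (hv : ∀ x, HasDerivAt v (v₁ x) x) (hv₁ : ∀ x, HasDerivAt v₁ (μ ^ 2 * v x - g x) x)
    (v0 : v 0 = 0) (vL : v L = 0) :
    ∫ x in (0 : ℝ)..L, quadProfile L μ x * g x =
      μ ^ 4 * cosh (μ * L / 2) * ∫ x in (0 : ℝ)..L, x * (L - x) / 2 * v x := by
  have cv : Continuous v := continuous_iff_continuousAt.2 fun x => (hv x).continuousAt
  have cK := continuous_quadProfile L μ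
  have h := integral_mul_deriv2_eq (L := L) (h := quadProfile L μ)
    (h₂ := fun x => μ ^ 2 * quadProfile L μ x
      - μ ^ 4 * cosh (μ * L / 2) * (x * (L - x) / 2))
    (fun x => ((hasDerivAt_mul_sub_half L x).const_mul _).fun_sub
      (hasDerivAt_constProfile L μ x))
    (fun x => by
      convert! (((hasDerivAt_id x).const_sub (L / 2)).const_mul _).fun_sub
        (hasDerivAt_deriv_constProfile L μ x) using 1
      simp only [quadProfile]
      ring) hv hv₁ (by fun_prop) (by fun_prop)
    (by simp [quadProfile, constProfile_zero]) (by simp [quadProfile, constProfile_right]) v0 vL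
  have e₁ : ∫ x in (0 : ℝ)..L, quadProfile L μ x * (μ ^ 2 * v x - g x) =
      μ ^ 2 * (∫ x in (0 : ℝ)..L, quadProfile L μ x * v x)
        - ∫ x in (0 : ℝ)..L, quadProfile L μ x * g x := by
    rw [← intervalIntegral.integral_const_mul, ← intervalIntegral.integral_sub
      ((by fun_prop : Continuous fun x => μ ^ 2 * (quadProfile L μ x * v x)).intervalIntegrable _ _)
      ((by fun_prop : Continuous fun x => quadProfile L μ x * g x).intervalIntegrable _ _)]
    congr 1; ext x; ring
  have e₂ : ∫ x in (0 : ℝ)..L, (μ ^ 2 * quadProfile L μ x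
        - μ ^ 4 * cosh (μ * L / 2) * (x * (L - x) / 2)) * v x =
      μ ^ 2 * (∫ x in (0 : ℝ)..L, quadProfile L μ x * v x)
        - μ ^ 4 * cosh (μ * L / 2) * ∫ x in (0 : ℝ)..L, x * (L - x) / 2 * v x := by
    rw [← intervalIntegral.integral_const_mul, ← intervalIntegral.integral_const_mul,
      ← intervalIntegral.integral_sub
      ((by fun_prop : Continuous fun x => μ ^ 2 * (quadProfile L μ x * v x)).intervalIntegrable _ _)
      ((by fun_prop : Continuous fun x =>
        μ ^ 4 * cosh (μ * L / 2) * (x * (L - x) / 2 * v x)).intervalIntegrable _ _)]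
    congr 1; ext x; ring
  linarith

theorem integral_quadProfile (L : ℝ) {μ : ℝ} (hμ : μ ≠ 0) :
    ∫ x in (0 : ℝ)..L, quadProfile L μ x = μ ^ 2 * cosh (μ * L / 2) * (L ^ 3 / 12)
      - (cosh (μ * L / 2) * L - 2 * sinh (μ * L / 2) / μ) := by
  rw [intervalIntegral.integral_eq_sub_of_hasDerivAt
    (f := fun x => μ ^ 2 * cosh (μ * L / 2) * (L * x ^ 2 / 4 - x ^ 3 / 6)
      - (cosh (μ * L / 2) * x - sinh (μ * (x - L / 2)) / μ))
    (fun x _ => ?_) ((continuous_quadProfile L μ).intervalIntegrable _ _)]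
  · rw [show μ * (L - L / 2) = μ * L / 2 by ring, show μ * (0 - L / 2) = -(μ * L / 2) by ring,
      sinh_neg]
    ring
  · convert! ((((((hasDerivAt_pow 2 x).const_mul L).div_const 4).fun_sub
      ((hasDerivAt_pow 3 x).div_const 6)).const_mul (μ ^ 2 * cosh (μ * L / 2)))).fun_sub
      (((hasDerivAt_id x).const_mul (cosh (μ * L / 2))).fun_sub
        (((((hasDerivAt_id x).sub_const (L / 2)).const_mul μ).sinh).div_const μ)) using 1
    simp only [quadProfile, constProfile, id]
    field_simp
    push_cast
    ring

theorem sigmaDen_identity (L : ℝ) {μ : ℝ} (hμ : μ ≠ 0) :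
    2 * sinh (μ * L / 2) ^ 2 * (μ * L / 2 * cosh (μ * L / 2) - sinh (μ * L / 2)) * μ
      - μ ^ 2 * ∫ x in (0 : ℝ)..L, quadProfile L μ x
      = μ * cosh (μ * L / 2) * sigmaDen (μ * L) / 12 := by
  rw [integral_quadProfile L hμ, sigmaDen]
  have e : μ * L = 2 * (μ * L / 2) := by ring
  have hc : cosh (μ * L) = cosh (μ * L / 2) ^ 2 + sinh (μ * L / 2) ^ 2 := by
    conv_lhs => rw [e]
    rw [cosh_two_mul]
  have hs : sinh (μ * L) = 2 * sinh (μ * L / 2) * cosh (μ * L / 2) := by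
    conv_lhs => rw [e]
    rw [sinh_two_mul]
  rw [hc, hs]
  have hsq := cosh_sq (μ * L / 2)
  generalize cosh (μ * L / 2) = C at *
  generalize sinh (μ * L / 2) = S at *
  field_simp
  linear_combination (-6 * L * C * μ + 24 * S) * hsq

/-- Positivity of the nonlocal Dirichlet problem `-v'' + μ² v + c ∫ φ v = f`, `φ = x (L - x) / 2`,
under the sharp bound on `c`. -/
theorem nonneg_of_nonlocal {L μ c U : ℝ} (hL : 0 < L) (hμ : 0 < μ) (hc : 0 < c)
    (hcond : c * sigmaDen (μ * L) ≤ 12 * μ ^ 5) {v v₁ f : ℝ → ℝ} (cf : Continuous f)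
    (hf : ∀ x ∈ Ioo 0 L, 0 ≤ f x) (hv : ∀ x, HasDerivAt v (v₁ x) x)
    (hv₁ : ∀ x, HasDerivAt v₁ (μ ^ 2 * v x - (f x - c * U)) x) (v0 : v 0 = 0) (vL : v L = 0)
    (hU : ∫ x in (0 : ℝ)..L, x * (L - x) / 2 * v x = U) : ∀ x ∈ Icc 0 L, 0 ≤ v x := by
  have cv : Continuous v := continuous_iff_continuousAt.2 fun x => (hv x).continuousAt
  have cE := continuous_constProfile L μ
  have cK := continuous_quadProfile L μ
  rcases le_or_gt U 0 with hU0 | hU0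
  · intro x hx
    have := nonpos_of_mul_le_deriv2 (f := fun x => -v x) (sq_nonneg μ) cv.neg.continuousOn
      (fun x _ => (hv x).fun_neg) (fun x _ => (hv₁ x).fun_neg)
      (fun x hx => by
        have := hf x hx
        have := mul_nonpos_of_nonneg_of_nonpos hc.le hU0
        linarith) (by simp [v0]) (by simp [vL]) x hx
    linarith
  intro x hx
  set C := cosh (μ * L / 2) with hC
  set S := sinh (μ * L / 2) with hS
  set J := ∫ x in (0 : ℝ)..L, quadProfile L μ x with hJ
  set k := μ * L / 2 * C - S with hk
  have Cpos : 0 < C := cosh_pos _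
  have Spos : 0 < S := sinh_pos_iff.2 (by positivity)
  have kpos : 0 < k := sub_pos.2 (sinh_lt_mul_cosh (by positivity))
  have hs : sinh (μ * L) = 2 * S * C := by
    rw [hS, hC, ← sinh_two_mul]
    ring_nf
  have hI : ∫ x in (0 : ℝ)..L, quadProfile L μ x * f x = (μ ^ 4 * C + c * J) * U := by
    have h := integral_quadProfile_mul (by fun_prop : Continuous fun x => f x - c * U) hv hv₁ v0 vL
    have e : ∫ x in (0 : ℝ)..L, quadProfile L μ x * (f x - c * U) =
        (∫ x in (0 : ℝ)..L, quadProfile L μ x * f x) - c * U * J := by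
      rw [hJ, ← intervalIntegral.integral_const_mul, ← intervalIntegral.integral_sub
        ((by fun_prop : Continuous fun x => quadProfile L μ x * f x).intervalIntegrable _ _)
        ((by fun_prop : Continuous fun x => c * U * quadProfile L μ x).intervalIntegrable _ _)]
      congr 1; ext x; ring
    rw [e, hU] at h
    linarith
  set u : ℝ → ℝ := fun x => v x + c * U / (μ ^ 2 * C) * constProfile L μ x with hu
  have hrep := mul_sinh_eq_of_deriv2 (L := L) (μ := μ) (u := u) cf
    (fun x => (hv x).fun_add ((hasDerivAt_constProfile L μ x).const_mul _))
    (fun x => by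
      convert! (hv₁ x).fun_add ((hasDerivAt_deriv_constProfile L μ x).const_mul
        (c * U / (μ ^ 2 * C))) using 1
      simp only [hu]
      rw [← hC]
      field_simp
      ring)
    (by simp [hu, v0, constProfile_zero]) (by simp [hu, vL, constProfile_right]) x
  have hx' : L - x ∈ Icc 0 L := ⟨by linarith [hx.2], by linarith [hx.1]⟩
  set E := constProfile L μ x with hE
  have E0 : 0 ≤ E := constProfile_nonneg hμ hx
  have hE₁ : E ≤ S * sinh (μ * x) := constProfile_le L μ x
  have hE₂ : E ≤ S * sinh (μ * (L - x)) := by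
    rw [hE, ← constProfile_sub]
    exact constProfile_le L μ (L - x)
  have iK : ∀ a b, IntervalIntegrable (fun s => quadProfile L μ s * f s) volume a b := fun a b =>
    (by fun_prop : Continuous fun s => quadProfile L μ s * f s).intervalIntegrable a b
  have hleft : E * (∫ s in (0 : ℝ)..x, quadProfile L μ s * f s) ≤
      S * sinh (μ * (L - x)) * k * ∫ s in (0 : ℝ)..x, sinh (μ * s) * f s := by
    rw [← intervalIntegral.integral_const_mul, ← intervalIntegral.integral_const_mul]
    refine intervalIntegral.integral_mono_on_of_le_Ioo hx.1 ((iK 0 x).const_mul _)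
      ((by fun_prop : Continuous fun s =>
        S * sinh (μ * (L - x)) * k * (sinh (μ * s) * f s)).intervalIntegrable _ _) fun s hs => ?_
    have hsI : s ∈ Ioo 0 L := ⟨hs.1, hs.2.trans_le hx.2⟩
    have hfs := hf s hsI
    have h₁ := quadProfile_le hμ (Ioo_subset_Icc_self hsI)
    have h₂ : 0 ≤ k * sinh (μ * s) :=
      mul_nonneg kpos.le (sinh_nonneg_iff.2 (mul_nonneg hμ.le hs.1.le))
    have h₃ : E * quadProfile L μ s ≤ S * sinh (μ * (L - x)) * (k * sinh (μ * s)) :=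
      (mul_le_mul_of_nonneg_left h₁ E0).trans (mul_le_mul_of_nonneg_right hE₂ h₂)
    linarith [mul_le_mul_of_nonneg_right h₃ hfs]
  have hright : E * (∫ s in x..L, quadProfile L μ s * f s) ≤
      S * sinh (μ * x) * k * ∫ s in x..L, sinh (μ * (L - s)) * f s := by
    rw [← intervalIntegral.integral_const_mul, ← intervalIntegral.integral_const_mul]
    refine intervalIntegral.integral_mono_on_of_le_Ioo hx.2 ((iK x L).const_mul _)
      ((by fun_prop : Continuous fun s =>
        S * sinh (μ * x) * k * (sinh (μ * (L - s)) * f s)).intervalIntegrable _ _) fun s hs => ?_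
    have hsI : s ∈ Ioo 0 L := ⟨hx.1.trans_lt hs.1, hs.2⟩
    have hfs := hf s hsI
    have h₁ := quadProfile_le (L := L) (x := L - s) hμ ⟨by linarith [hs.2], by linarith [hsI.1]⟩
    rw [quadProfile_sub] at h₁
    have h₂ : 0 ≤ k * sinh (μ * (L - s)) :=
      mul_nonneg kpos.le (sinh_nonneg_iff.2 (mul_nonneg hμ.le (by linarith [hs.2])))
    have h₃ : E * quadProfile L μ s ≤ S * sinh (μ * x) * (k * sinh (μ * (L - s))) :=
      (mul_le_mul_of_nonneg_left h₁ E0).trans (mul_le_mul_of_nonneg_right hE₁ h₂)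
    linarith [mul_le_mul_of_nonneg_right h₃ hfs]
  have hsplit := intervalIntegral.integral_add_adjacent_intervals (iK 0 x) (iK x L)
  have hlow : E * ((μ ^ 4 * C + c * J) * U) ≤ S * k * (u x * (μ * (2 * S * C))) := by
    rw [← hI, ← hsplit, ← hs, hrep]
    linarith
  have hid := sigmaDen_identity L hμ.ne'
  rw [← hC, ← hS, ← hJ, ← hk] at hid
  have hkey : c * (2 * S ^ 2 * k * μ) ≤ μ ^ 2 * (μ ^ 4 * C + c * J) := by
    have := mul_le_mul_of_nonneg_left hcond (by positivity : 0 ≤ μ * C / 12)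
    linear_combination this + c * hid
  have hfin : c * (2 * S ^ 2 * k * μ) * (E * U) ≤ μ ^ 2 * (S * k * (u x * (μ * (2 * S * C)))) := by
    have h₁ := mul_le_mul_of_nonneg_right hkey (mul_nonneg E0 hU0.le)
    have h₂ := mul_le_mul_of_nonneg_left hlow (sq_nonneg μ)
    linarith
  have hvx : v x = u x - c * U / (μ ^ 2 * C) * E := by simp [hu, hE]
  rw [hvx, sub_nonneg, div_mul_eq_mul_div, div_le_iff₀ (by positivity)]
  refine le_of_mul_le_mul_left (a := 2 * S ^ 2 * k * μ) ?_ (by positivity)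
  linarith

end Positivity

section CriticalConstant

theorem mul_sigmaDen_le_of_le_sigmaFun {L c M : ℝ} (hL : 0 < L) (hc : 0 ≤ c) (hM : 0 < M)
    (h : c ≤ 4 * M / L ^ 3 * sigmaFun (√M * L)) :
    c * sigmaDen (√M * L) ≤ 12 * √M ^ 5 := by
  rcases le_or_gt (sigmaDen (√M * L)) 0 with hD | hD
  · exact (mul_nonpos_of_nonneg_of_nonpos hc hD).trans (by positivity)
  · have e : sigmaFun (√M * L) = 3 * (√M * L) ^ 3 / sigmaDen (√M * L) := rfl
    rw [e, ← mul_div_assoc, le_div_iff₀ hD] at h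
    have hsq : √M ^ 2 = M := sq_sqrt hM.le
    refine h.trans_eq ?_
    field_simp
    linear_combination (-12) * hsq

theorem mul_sigmaDen_le_mono {L c μ ν : ℝ} (hL : 0 < L) (hc : 0 ≤ c) (hμ : 0 < μ) (hμν : μ ≤ ν)
    (h : c * sigmaDen (ν * L) ≤ 12 * ν ^ 5) : c * sigmaDen (μ * L) ≤ 12 * μ ^ 5 := by
  have hν : 0 < ν := hμ.trans_le hμν
  have h₁ := mul_le_mul_of_nonneg_left (sigmaDen_div_pow_five_le (mul_pos hμ hL)
    (mul_le_mul_of_nonneg_right hμν hL.le)) hc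
  have h₂ : c * (sigmaDen (ν * L) / (ν * L) ^ 5) ≤ 12 / L ^ 5 := by
    rw [← mul_div_assoc, div_le_div_iff₀ (by positivity) (by positivity), mul_pow, ← mul_assoc]
    exact mul_le_mul_of_nonneg_right h (by positivity)
  have h₃ := h₁.trans h₂
  rw [← mul_div_assoc, div_le_div_iff₀ (by positivity) (by positivity), mul_pow, ← mul_assoc] at h₃
  exact le_of_mul_le_mul_right h₃ (by positivity)

theorem mul_sigmaDen_le_of_le {c d x y : ℝ} (hc : 0 ≤ c) (hcd : c ≤ d) (hy : 0 ≤ y)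
    (h : d * sigmaDen x ≤ y) : c * sigmaDen x ≤ y := by
  rcases le_or_gt (sigmaDen x) 0 with hD | hD
  · exact (mul_nonpos_of_nonneg_of_nonpos hc hD).trans hy
  · exact (mul_le_mul_of_nonneg_right hcd hD.le).trans h

end CriticalConstant

section Sine

theorem hasDerivAt_sin_pi_mul_div (L x : ℝ) :
    HasDerivAt (fun x => sin (π * x / L)) (π / L * cos (π * x / L)) x := by
  convert! (((hasDerivAt_id x).const_mul π).div_const L).sin using 1
  simp only [id]
  ring

theorem hasDerivAt_cos_pi_mul_div (L x : ℝ) :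
    HasDerivAt (fun x => cos (π * x / L)) (-(π / L * sin (π * x / L))) x := by
  convert! (((hasDerivAt_id x).const_mul π).div_const L).cos using 1
  simp only [id]
  ring

theorem integral_sin_pi_mul_div {L : ℝ} (hL : L ≠ 0) :
    ∫ x in (0 : ℝ)..L, sin (π * x / L) = 2 * L / π := by
  have hpi := pi_ne_zero
  rw [intervalIntegral.integral_eq_sub_of_hasDerivAt (f := fun x => -(L / π * cos (π * x / L)))
    (fun x _ => ?_) ((by fun_prop : Continuous fun x => sin (π * x / L)).intervalIntegrable _ _)]
  · rw [mul_div_cancel_right₀ _ hL]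
    simp
    ring
  · convert! ((hasDerivAt_cos_pi_mul_div L x).const_mul (L / π)).fun_neg using 1
    field_simp

theorem integral_mul_sin_pi_mul_div {L : ℝ} (hL : L ≠ 0) (lam : ℝ) :
    ∫ x in (0 : ℝ)..L, x * (L - x) / 2 * (lam * (π ^ 2 / L ^ 2) * sin (π * x / L)) =
      2 * lam * L / π := by
  rw [← integral_eq_integral_mul_of_deriv2 (w := fun x => lam * sin (π * x / L))
    (fun x => (hasDerivAt_sin_pi_mul_div L x).const_mul lam)
    (fun x => ?_) (by fun_prop) (by simp) (by simp [hL]),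
    intervalIntegral.integral_const_mul, integral_sin_pi_mul_div hL]
  · ring
  · convert! ((hasDerivAt_cos_pi_mul_div L x).const_mul (π / L)).const_mul lam using 1
    ring

end Sine

section Existence

/-- A value `U` of the total deflection which is consistent with the linear problem in which
`U` is frozen. -/
theorem exists_consistent_deflection {L a b c lam : ℝ} (hL : 0 < L) (ha : 0 < a) (hb : 0 < b)
    (hlam : 0 < lam) {P : ℝ → ℝ} (cP : Continuous P) (hP0 : ∀ x ∈ Ioo 0 L, 0 ≤ P x)
    (hP1 : ∀ x ∈ Ioo 0 L,
      P x ≤ (lam * π ^ 4 / L ^ 4 + a * lam * π ^ 2 / L ^ 2 + 2 * b * lam ^ 2 * π / L)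
          * sin (π * x / L) + 2 * lam * c * L / π) :
    ∃ U ∈ Icc 0 (2 * lam * L / π), ∃ v v₁ : ℝ → ℝ, (∀ x, HasDerivAt v (v₁ x) x) ∧
      (∀ x, HasDerivAt v₁ (√(a + b * U) ^ 2 * v x - (P x - c * U)) x) ∧ v 0 = 0 ∧ v L = 0 ∧
      ∫ x in (0 : ℝ)..L, x * (L - x) / 2 * v x = U := by
  have hφ : ∀ x ∈ Icc 0 L, 0 ≤ x * (L - x) / 2 := fun x hx =>
    div_nonneg (mul_nonneg hx.1 (by linarith [hx.2])) (by norm_num)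
  set μ : ℝ → ℝ := fun U => √(a + b * |U|) with hμ
  have cμ : Continuous μ := by fun_prop
  have hμpos : ∀ U, 0 < μ U := fun U => sqrt_pos.2 (by positivity)
  set κ : ℝ → ℝ := fun U => μ U ^ 4 * cosh (μ U * L / 2) with hκ
  have hκpos : ∀ U, 0 < κ U := fun U => mul_pos (pow_pos (hμpos U) 4) (cosh_pos _)
  have hex : ∀ U, ∃ v v₁ : ℝ → ℝ, (∀ x, HasDerivAt v (v₁ x) x) ∧
      (∀ x, HasDerivAt v₁ (μ U ^ 2 * v x - (P x - c * U)) x) ∧ v 0 = 0 ∧ v L = 0 := fun U =>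
    exists_deriv2_eq_mul_sub hL (hμpos U) (by fun_prop)
  set ψ : ℝ → ℝ := fun U =>
    (∫ x in (0 : ℝ)..L, quadProfile L (μ U) x * (P x - c * U)) - κ U * U with hψ
  have hψ_eq : ∀ U, ∀ v v₁ : ℝ → ℝ, (∀ x, HasDerivAt v (v₁ x) x) →
      (∀ x, HasDerivAt v₁ (μ U ^ 2 * v x - (P x - c * U)) x) → v 0 = 0 → v L = 0 →
      ψ U = κ U * ((∫ x in (0 : ℝ)..L, x * (L - x) / 2 * v x) - U) := by
    intro U v v₁ hv hv₁ v0 vL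
    simp only [hψ]
    rw [integral_quadProfile_mul (by fun_prop) hv hv₁ v0 vL, mul_sub]
  have cψ : Continuous ψ := by
    refine Continuous.sub ?_ (by fun_prop)
    apply intervalIntegral.continuous_parametric_intervalIntegral_of_continuous'
    unfold quadProfile constProfile
    fun_prop
  have hψ0 : 0 ≤ ψ 0 := by
    obtain ⟨v, v₁, hv, hv₁, v0, vL⟩ := hex 0
    have cv : Continuous v := continuous_iff_continuousAt.2 fun x => (hv x).continuousAt
    rw [hψ_eq 0 v v₁ hv hv₁ v0 vL, sub_zero]
    refine mul_nonneg (hκpos 0).le (intervalIntegral.integral_nonneg hL.le fun x hx =>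
      mul_nonneg (hφ x hx) ?_)
    have := nonpos_of_mul_le_deriv2 (f := fun x => -v x) (sq_nonneg (μ 0)) cv.neg.continuousOn
      (fun x _ => (hv x).fun_neg) (fun x _ => (hv₁ x).fun_neg)
      (fun x hx => by linarith [hP0 x hx]) (by simp [v0]) (by simp [vL]) x hx
    linarith
  have hU₀ : 0 ≤ 2 * lam * L / π := by have := pi_pos; positivity
  have hψ1 : ψ (2 * lam * L / π) ≤ 0 := by
    set U := 2 * lam * L / π with hU
    obtain ⟨v, v₁, hv, hv₁, v0, vL⟩ := hex U
    have cv : Continuous v := continuous_iff_continuousAt.2 fun x => (hv x).continuousAt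
    rw [hψ_eq U v v₁ hv hv₁ v0 vL]
    refine mul_nonpos_of_nonneg_of_nonpos (hκpos U).le (sub_nonpos.2 ?_)
    conv_rhs => rw [hU, ← integral_mul_sin_pi_mul_div hL.ne' lam]
    refine intervalIntegral.integral_mono_on hL.le
      ((by fun_prop : Continuous fun x => x * (L - x) / 2 * v x).intervalIntegrable _ _)
      ((by fun_prop : Continuous fun x => x * (L - x) / 2 *
        (lam * (π ^ 2 / L ^ 2) * sin (π * x / L))).intervalIntegrable _ _)
      fun x hx => mul_le_mul_of_nonneg_left ?_ (hφ x hx)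
    have hμU : μ U ^ 2 = a + b * U := by
      rw [hμ]
      simp only [abs_of_nonneg hU₀]
      exact sq_sqrt (by positivity)
    have := nonpos_of_mul_le_deriv2 (L := L)
      (f := fun x => v x - lam * (π ^ 2 / L ^ 2) * sin (π * x / L)) (sq_nonneg (μ U))
      (by fun_prop)
      (fun x _ => (hv x).fun_sub ((hasDerivAt_sin_pi_mul_div L x).const_mul _))
      (fun x _ => (hv₁ x).fun_sub
        (((hasDerivAt_cos_pi_mul_div L x).const_mul (π / L)).const_mul _))
      (fun x hx => by
        have h := hP1 x hx
        have hpi := pi_pos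
        rw [hμU]
        have e : (lam * π ^ 4 / L ^ 4 + a * lam * π ^ 2 / L ^ 2 + 2 * b * lam ^ 2 * π / L)
            * sin (π * x / L) + 2 * lam * c * L / π =
            (a + b * U) * (lam * (π ^ 2 / L ^ 2) * sin (π * x / L))
            + lam * (π ^ 2 / L ^ 2) * (π / L * (π / L * sin (π * x / L))) + c * U := by
          rw [hU]
          field_simp
          ring
        rw [e] at h
        linarith)
      (by simp [v0]) (by simp [vL, hL.ne']) x hx
    linarith
  obtain ⟨U, hU, hψU⟩ := intermediate_value_Icc' hU₀ cψ.continuousOn ⟨hψ1, hψ0⟩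
  obtain ⟨v, v₁, hv, hv₁, v0, vL⟩ := hex U
  refine ⟨U, hU, v, v₁, hv, ?_, v0, vL, ?_⟩
  · simpa only [hμ, abs_of_nonneg hU.1] using hv₁
  · rw [hψ_eq U v v₁ hv hv₁ v0 vL] at hψU
    exact sub_eq_zero.1 ((mul_eq_zero.1 hψU).resolve_left (hκpos U).ne')

theorem contDiff_succ_of_hasDerivAt {n : ℕ} {f f' : ℝ → ℝ} (hf : ∀ x, HasDerivAt f (f' x) x)
    (hf' : ContDiff ℝ n f') : ContDiff ℝ (n + 1 : ℕ) f := by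
  have e : deriv f = f' := funext fun x => (hf x).deriv
  push_cast
  rw [contDiff_succ_iff_deriv]
  exact ⟨fun x => (hf x).differentiableAt, by simp, by rwa [e]⟩

theorem iteratedDerivWithin_Icc_of_hasDerivAt {L : ℝ} (hL : 0 < L) {w w₁ w₂ w₃ w₄ : ℝ → ℝ}
    (h₁ : ∀ x, HasDerivAt w (w₁ x) x) (h₂ : ∀ x, HasDerivAt w₁ (w₂ x) x)
    (h₃ : ∀ x, HasDerivAt w₂ (w₃ x) x) (h₄ : ∀ x, HasDerivAt w₃ (w₄ x) x) (cw₄ : Continuous w₄) :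
    ContDiff ℝ 4 w ∧
      (∀ x ∈ Icc 0 L, iteratedDerivWithin 2 w (Icc 0 L) x = w₂ x) ∧
      ∀ x ∈ Icc 0 L, iteratedDerivWithin 4 w (Icc 0 L) x = w₄ x := by
  have hw : ContDiff ℝ 4 w :=
    contDiff_succ_of_hasDerivAt h₁ (contDiff_succ_of_hasDerivAt h₂ (contDiff_succ_of_hasDerivAt h₃
      (contDiff_succ_of_hasDerivAt h₄ (contDiff_zero.2 cw₄))))
  have e₁ : deriv w = w₁ := funext fun x => (h₁ x).deriv
  have e₂ : deriv w₁ = w₂ := funext fun x => (h₂ x).deriv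
  have e₃ : deriv w₂ = w₃ := funext fun x => (h₃ x).deriv
  have e₄ : deriv w₃ = w₄ := funext fun x => (h₄ x).deriv
  have hs := uniqueDiffOn_Icc hL
  refine ⟨hw, fun x hx => ?_, fun x hx => ?_⟩
  · rw [iteratedDerivWithin_eq_iteratedDeriv hs
      (hw.contDiffAt.of_le (by norm_num)) hx]
    simp [iteratedDeriv_succ', e₁, e₂]
  · rw [iteratedDerivWithin_eq_iteratedDeriv hs hw.contDiffAt hx]
    simp [iteratedDeriv_succ', e₁, e₂, e₃, e₄]

end Existence

section Comparison

theorem ContDiffOn.hasDerivAt_iteratedDerivWithin_Icc {L : ℝ} {n k : ℕ} {y : ℝ → ℝ}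
    (hy : ContDiffOn ℝ n y (Icc 0 L)) (hk : k < n) {x : ℝ} (hx : x ∈ Ioo 0 L) :
    HasDerivAt (iteratedDerivWithin k y (Icc 0 L))
      (iteratedDerivWithin (k + 1) y (Icc 0 L) x) x := by
  have hs := uniqueDiffOn_Icc (hx.1.trans hx.2)
  rw [iteratedDerivWithin_succ]
  exact (hy.differentiableOn_iteratedDerivWithin (by exact_mod_cast hk) hs x
    (Ioo_subset_Icc_self hx)).hasDerivWithinAt.hasDerivAt (Icc_mem_nhds hx.1 hx.2)

/-- Among concave solutions, a larger total deflection forces a pointwise smaller deflection. -/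
theorem IsMelanSolution.le_of_integral_le {L a b c : ℝ} (hL : 0 < L) (ha : 0 < a) (hb : 0 < b)
    (hc : 0 < c) {p y₁ y₂ : ℝ → ℝ} (h₁ : IsMelanSolution L a b c p y₁)
    (h₂ : IsMelanSolution L a b c p y₂) (hpos : 0 ≤ ∫ t in (0 : ℝ)..L, y₁ t)
    (hle : ∫ t in (0 : ℝ)..L, y₂ t ≤ ∫ t in (0 : ℝ)..L, y₁ t)
    (hconc : ∀ x ∈ Icc 0 L, iteratedDerivWithin 2 y₂ (Icc 0 L) x ≤ 0) :
    ∀ x ∈ Icc 0 L, y₁ x ≤ y₂ x := by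
  obtain ⟨s₁, ode₁, l₁, r₁, l₁', r₁'⟩ := h₁
  obtain ⟨s₂, ode₂, l₂, r₂, l₂', r₂'⟩ := h₂
  have hs := uniqueDiffOn_Icc hL
  set U₁ := ∫ t in (0 : ℝ)..L, y₁ t
  set U₂ := ∫ t in (0 : ℝ)..L, y₂ t
  have hV := nonpos_of_mul_le_deriv2 (L := L) (m := a + b * U₁) (by positivity)
    (f := fun x => iteratedDerivWithin 2 y₂ (Icc 0 L) x - iteratedDerivWithin 2 y₁ (Icc 0 L) x)
    ((s₂.continuousOn_iteratedDerivWithin (by norm_num) hs).sub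
      (s₁.continuousOn_iteratedDerivWithin (by norm_num) hs))
    (fun x hx => (s₂.hasDerivAt_iteratedDerivWithin_Icc (n := 4) (by norm_num) hx).fun_sub
      (s₁.hasDerivAt_iteratedDerivWithin_Icc (n := 4) (by norm_num) hx))
    (fun x hx => (s₂.hasDerivAt_iteratedDerivWithin_Icc (n := 4) (by norm_num) hx).fun_sub
      (s₁.hasDerivAt_iteratedDerivWithin_Icc (n := 4) (by norm_num) hx))
    (fun x hx => by
      have o₁ := ode₁ x hx
      have o₂ := ode₂ x hx
      have i₁ := mul_nonneg hb.le (mul_nonneg (sub_nonneg.2 hle)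
        (neg_nonneg.2 (hconc x (Ioo_subset_Icc_self hx))))
      have i₂ := mul_nonneg hc.le (sub_nonneg.2 hle)
      simp only [Nat.reduceAdd]
      linarith)
    (by simp [l₁', l₂']) (by simp [r₁', r₂'])
  have hz := nonpos_of_mul_le_deriv2 (L := L) (m := 0) le_rfl (f := fun x => y₁ x - y₂ x)
    (s₁.continuousOn.sub s₂.continuousOn)
    (fun x hx => by
      have d₁ := s₁.hasDerivAt_iteratedDerivWithin_Icc (n := 4) (k := 0) (by norm_num) hx
      have d₂ := s₂.hasDerivAt_iteratedDerivWithin_Icc (n := 4) (k := 0) (by norm_num) hx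
      rw [iteratedDerivWithin_zero] at d₁ d₂
      exact d₁.fun_sub d₂)
    (fun x hx => (s₁.hasDerivAt_iteratedDerivWithin_Icc (n := 4) (by norm_num) hx).fun_sub
      (s₂.hasDerivAt_iteratedDerivWithin_Icc (n := 4) (by norm_num) hx))
    (fun x hx => by
      have := hV x (Ioo_subset_Icc_self hx)
      simp only [Nat.reduceAdd]
      linarith)
    (by simp [l₁, l₂]) (by simp [r₁, r₂])
  exact fun x hx => sub_nonpos.1 (hz x hx)

theorem IsMelanSolution.eq_of_concave {L a b c : ℝ} (hL : 0 < L) (ha : 0 < a) (hb : 0 < b)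
    (hc : 0 < c) {p y₁ y₂ : ℝ → ℝ} (h₁ : IsMelanSolution L a b c p y₁)
    (h₂ : IsMelanSolution L a b c p y₂) (hpos₁ : ∀ x ∈ Icc 0 L, 0 ≤ y₁ x)
    (hpos₂ : ∀ x ∈ Icc 0 L, 0 ≤ y₂ x)
    (hconc₁ : ∀ x ∈ Icc 0 L, iteratedDerivWithin 2 y₁ (Icc 0 L) x ≤ 0)
    (hconc₂ : ∀ x ∈ Icc 0 L, iteratedDerivWithin 2 y₂ (Icc 0 L) x ≤ 0) :
    ∀ x ∈ Icc 0 L, y₁ x = y₂ x := by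
  wlog hle : ∫ t in (0 : ℝ)..L, y₂ t ≤ ∫ t in (0 : ℝ)..L, y₁ t generalizing y₁ y₂
  · exact fun x hx =>
      (this h₂ h₁ hpos₂ hpos₁ hconc₂ hconc₁ (le_of_not_ge hle) x hx).symm
  have i : ∀ {y : ℝ → ℝ}, IsMelanSolution L a b c p y → IntervalIntegrable y volume 0 L :=
    fun h => h.1.continuousOn.intervalIntegrable_of_Icc hL.le
  have h₁₂ := h₁.le_of_integral_le hL ha hb hc h₂
    (intervalIntegral.integral_nonneg hL.le hpos₁) hle hconc₂
  have h₂₁ := h₂.le_of_integral_le hL ha hb hc h₁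
    (intervalIntegral.integral_nonneg hL.le hpos₂)
    (intervalIntegral.integral_mono_on hL.le (i h₁) (i h₂) h₁₂) hconc₁
  exact fun x hx => le_antisymm (h₁₂ x hx) (h₂₁ x hx)

end Comparison

section Concavity

/-- A nonnegative function that is concave on `[0, L]` is positive inside or vanishes there. -/
theorem pos_or_eq_zero_of_deriv2_nonpos {L : ℝ} {w w₁ w₂ : ℝ → ℝ}
    (hw : ∀ x, HasDerivAt w (w₁ x) x) (hw₁ : ∀ x, HasDerivAt w₁ (w₂ x) x)
    (h₂ : ∀ x ∈ Icc 0 L, w₂ x ≤ 0) (h₀ : ∀ x ∈ Icc 0 L, 0 ≤ w x) :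
    (∀ x ∈ Ioo 0 L, 0 < w x) ∨ ∀ x ∈ Icc 0 L, w x = 0 := by
  by_contra! h
  obtain ⟨⟨x₀, hx₀, hle⟩, y, hy, hne⟩ := h
  have hz : w x₀ = 0 := le_antisymm hle (h₀ x₀ (Ioo_subset_Icc_self hx₀))
  have hmin : IsLocalMin w x₀ := by
    filter_upwards [Icc_mem_nhds hx₀.1 hx₀.2] with t ht
    exact hz ▸ h₀ t ht
  have hcrit : w₁ x₀ = 0 := hmin.hasDerivAt_eq_zero (hw x₀)
  have hanti : AntitoneOn w₁ (Icc 0 L) :=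
    antitoneOn_of_hasDerivWithinAt_nonpos (convex_Icc 0 L)
      (fun x _ => (hw₁ x).continuousAt.continuousWithinAt)
      (fun x _ => (hw₁ x).hasDerivWithinAt) fun x hx => h₂ x (interior_subset hx)
  have cw : ∀ s, ContinuousOn w s := fun s x _ => (hw x).continuousAt.continuousWithinAt
  refine hne (le_antisymm ?_ (h₀ y hy))
  rcases le_total x₀ y with hxy | hxy
  · have : AntitoneOn w (Icc x₀ L) :=
      antitoneOn_of_hasDerivWithinAt_nonpos (convex_Icc x₀ L) (cw _)
        (fun x _ => (hw x).hasDerivWithinAt) fun x hx => by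
          have hx := interior_subset hx
          exact hcrit ▸ hanti (Ioo_subset_Icc_self hx₀) ⟨hx₀.1.le.trans hx.1, hx.2⟩ hx.1
    exact hz ▸ this ⟨le_rfl, hx₀.2.le⟩ ⟨hxy, hy.2⟩ hxy
  · have : MonotoneOn w (Icc 0 x₀) :=
      monotoneOn_of_hasDerivWithinAt_nonneg (convex_Icc 0 x₀) (cw _)
        (fun x _ => (hw x).hasDerivWithinAt) fun x hx => by
          have hx := interior_subset hx
          exact hcrit ▸ hanti ⟨hx.1, hx.2.trans hx₀.2.le⟩ (Ioo_subset_Icc_self hx₀) hx.2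
    exact hz ▸ this ⟨hy.1, hxy⟩ ⟨hx₀.1.le, le_rfl⟩ hxy

theorem HasDerivAt.eq_zero_of_eqOn_zero {L x f' : ℝ} {f : ℝ → ℝ} (hf : HasDerivAt f f' x)
    (h : ∀ y ∈ Ioo 0 L, f y = 0) (hx : x ∈ Ioo 0 L) : f' = 0 :=
  hf.unique ((hasDerivAt_const x (0 : ℝ)).congr_of_eventuallyEq <| by
    filter_upwards [Ioo_mem_nhds hx.1 hx.2] with y hy using h y hy)

end Concavity

section BendingMoment

/-- The consistent bending moment is nonnegative and lies below that of `lam * sin (π x / L)`. -/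
theorem bending_moment_mem_Icc {L a b c lam : ℝ} (hL : 0 < L) (ha : 0 < a) (hb : 0 < b)
    (hc : 0 < c) (hlam : 0 < lam) {P v v₁ : ℝ → ℝ} (cP : Continuous P)
    (hP0 : ∀ x ∈ Ioo 0 L, 0 ≤ P x)
    (hP1 : ∀ x ∈ Ioo 0 L,
      P x ≤ (lam * π ^ 4 / L ^ 4 + a * lam * π ^ 2 / L ^ 2 + 2 * b * lam ^ 2 * π / L)
          * sin (π * x / L) + 2 * lam * c * L / π)
    (hkey : c + b * lam * π ^ 2 / L ^ 2
      ≤ 4 * (a + 2 * b * lam * L / π) / L ^ 3 * sigmaFun (√(a + 2 * b * lam * L / π) * L))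
    {U : ℝ} (hU : U ∈ Icc 0 (2 * lam * L / π)) (hv : ∀ x, HasDerivAt v (v₁ x) x)
    (hv₁ : ∀ x, HasDerivAt v₁ (√(a + b * U) ^ 2 * v x - (P x - c * U)) x) (v0 : v 0 = 0)
    (vL : v L = 0) (hint : ∫ x in (0 : ℝ)..L, x * (L - x) / 2 * v x = U) :
    ∀ x ∈ Icc 0 L, 0 ≤ v x ∧ v x ≤ lam * (π ^ 2 / L ^ 2) * sin (π * x / L) := by
  have hpi := pi_pos
  have hM : 0 < a + b * U := by have := mul_nonneg hb.le hU.1; linarith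
  have hbU : b * U ≤ 2 * b * lam * L / π :=
    (mul_le_mul_of_nonneg_left hU.2 hb.le).trans_eq (by ring)
  set d := c + b * lam * π ^ 2 / L ^ 2 with hd
  have hcd : c ≤ d := le_add_of_nonneg_right (by positivity)
  have hμ : 0 < √(a + b * U) := sqrt_pos.2 hM
  have hdcond : d * sigmaDen (√(a + b * U) * L) ≤ 12 * √(a + b * U) ^ 5 :=
    mul_sigmaDen_le_mono hL (hc.le.trans hcd) hμ (sqrt_le_sqrt (by linarith))
      (mul_sigmaDen_le_of_le_sigmaFun hL (hc.le.trans hcd) (by positivity) hkey)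
  have hccond := mul_sigmaDen_le_of_le hc.le hcd (by positivity) hdcond
  have hsq : √(a + b * U) ^ 2 = a + b * U := sq_sqrt hM.le
  have cv : Continuous v := continuous_iff_continuousAt.2 fun x => (hv x).continuousAt
  have upper := nonneg_of_nonlocal hL hμ (hc.trans_le hcd) hdcond
    (U := 2 * lam * L / π - U)
    (v := fun x => lam * (π ^ 2 / L ^ 2) * sin (π * x / L) - v x)
    (v₁ := fun x => lam * (π ^ 2 / L ^ 2) * (π / L * cos (π * x / L)) - v₁ x)
    (f := fun x => d * (2 * lam * L / π - U) + (lam * π ^ 4 / L ^ 4 * sin (π * x / L)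
      + √(a + b * U) ^ 2 * (lam * (π ^ 2 / L ^ 2) * sin (π * x / L)) - P x + c * U))
    (by fun_prop) ?_ (fun x => ((hasDerivAt_sin_pi_mul_div L x).const_mul _).fun_sub (hv x))
    (fun x => ?_) (by simp [v0]) (by simp [vL, hL.ne']) ?_
  · exact fun x hx => ⟨nonneg_of_nonlocal hL hμ hc hccond cP hP0 hv hv₁ v0 vL hint x hx,
      sub_nonneg.1 (upper x hx)⟩
  · intro x hx
    have hs := sin_le_one (π * x / L)
    have key : 0 ≤ b * (lam * π ^ 2 / L ^ 2) * (2 * lam * L / π - U) * (1 - sin (π * x / L)) := by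
      have h₁ : 0 ≤ 1 - sin (π * x / L) := by linarith
      have h₂ : 0 ≤ 2 * lam * L / π - U := by linarith [hU.2]
      positivity
    refine key.trans ?_
    have := hP1 x hx
    rw [hsq, hd]
    rw [← sub_nonneg] at this ⊢
    refine this.trans_eq ?_
    field_simp
    ring
  · convert! (((hasDerivAt_cos_pi_mul_div L x).const_mul (π / L)).const_mul
      (lam * (π ^ 2 / L ^ 2))).fun_sub (hv₁ x) using 1
    field_simp
    ring
  · simp only [mul_sub (_ / 2 : ℝ)]
    rw [intervalIntegral.integral_sub, hint, integral_mul_sin_pi_mul_div hL.ne']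
    all_goals exact Continuous.intervalIntegrable (by fun_prop) _ _

end BendingMoment

theorem stmt17 (L a b c : ℝ) (hL : 0 < L) (ha : 0 < a) (hb : 0 < b) (hc : 0 < c)
    (p : ℝ → ℝ) (hp : ContinuousOn p (Set.Icc 0 L))
    (hp0 : ∀ x ∈ Set.Icc (0:ℝ) L, 0 ≤ p x)
    (hpne : ∃ x ∈ Set.Icc (0:ℝ) L, p x ≠ 0)
    (lam : ℝ) (hlam : 0 < lam)
    (hp1 : ∀ x ∈ Set.Ioo (0:ℝ) L,
      p x ≤ (lam * π ^ 4 / L ^ 4 + a * lam * π ^ 2 / L ^ 2 + 2 * b * lam ^ 2 * π / L)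
          * Real.sin (π * x / L) + 2 * lam * c * L / π)
    (hkey : c + b * lam * π ^ 2 / L ^ 2
      ≤ 4 * (a + 2 * b * lam * L / π) / L ^ 3
          * sigmaFun (Real.sqrt (a + 2 * b * lam * L / π) * L))
    (huniq : lam * (L ^ 3 / 4) * (2 * b / π + b * π ^ 2 / 4) ≤ 1) :
    ∃ w : ℝ → ℝ,
      (IsMelanSolution L a b c p w ∧
        (∀ x ∈ Set.Icc (0:ℝ) L, 0 ≤ w x ∧ w x ≤ lam * Real.sin (π * x / L)) ∧
        (∀ x ∈ Set.Icc (0:ℝ) L,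
          iteratedDerivWithin 2 w (Set.Icc 0 L) x ≤ 0 ∧
          -(lam * (π ^ 2 / L ^ 2) * Real.sin (π * x / L))
            ≤ iteratedDerivWithin 2 w (Set.Icc 0 L) x) ∧
        (∀ x ∈ Set.Ioo (0:ℝ) L, 0 < w x)) ∧
      (∀ w' : ℝ → ℝ,
        (IsMelanSolution L a b c p w' ∧
          (∀ x ∈ Set.Icc (0:ℝ) L, 0 ≤ w' x ∧ w' x ≤ lam * Real.sin (π * x / L)) ∧
          (∀ x ∈ Set.Icc (0:ℝ) L,
            iteratedDerivWithin 2 w' (Set.Icc 0 L) x ≤ 0 ∧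
            -(lam * (π ^ 2 / L ^ 2) * Real.sin (π * x / L))
              ≤ iteratedDerivWithin 2 w' (Set.Icc 0 L) x)) →
        ∀ x ∈ Set.Icc (0:ℝ) L, w' x = w x) := by
  set P : ℝ → ℝ := IccExtend hL.le (domRestrict (Icc 0 L) p)
  have cP : Continuous P := (continuousOn_iff_continuous_domRestrict.1 hp).Icc_extend'
  have eP : ∀ x ∈ Icc 0 L, P x = p x := fun x hx => IccExtend_of_mem _ _ hx
  have hP0 : ∀ x ∈ Ioo 0 L, 0 ≤ P x := fun x hx => by
    rw [eP x (Ioo_subset_Icc_self hx)]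
    exact hp0 x (Ioo_subset_Icc_self hx)
  have hP1 : ∀ x ∈ Ioo 0 L, P x ≤ _ := fun x hx =>
    (eP x (Ioo_subset_Icc_self hx)).trans_le (hp1 x hx)
  obtain ⟨U, hU, v, v₁, hv, hv₁, v0, vL, hint⟩ :=
    exists_consistent_deflection hL ha hb hlam cP hP0 hP1
  have hvb := bending_moment_mem_Icc hL ha hb hc hlam cP hP0 hP1 hkey hU hv hv₁ v0 vL hint
  have hsq : √(a + b * U) ^ 2 = a + b * U :=
    sq_sqrt (add_nonneg ha.le (mul_nonneg hb.le hU.1))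
  have cv : Continuous v := continuous_iff_continuousAt.2 fun x => (hv x).continuousAt
  obtain ⟨w, w₁, hw, hw₁, w0, wL⟩ := exists_deriv2_eq_neg hL cv
  have hwU : ∫ x in (0 : ℝ)..L, w x = U :=
    (integral_eq_integral_mul_of_deriv2 hw hw₁ cv w0 wL).trans hint
  obtain ⟨sw, e₂, e₄⟩ := iteratedDerivWithin_Icc_of_hasDerivAt hL hw hw₁
    (fun x => (hv x).fun_neg) (fun x => (hv₁ x).fun_neg) (by fun_prop)
  have cw : Continuous w := sw.continuous
  have hmem0 : (0 : ℝ) ∈ Icc 0 L := left_mem_Icc.2 hL.le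
  have hmemL : L ∈ Icc 0 L := right_mem_Icc.2 hL.le
  have hsol : IsMelanSolution L a b c p w := by
    refine ⟨sw.contDiffOn, fun x hx => ?_, w0, wL, ?_, ?_⟩
    · have hx := Ioo_subset_Icc_self hx
      rw [hwU, e₂ x hx, e₄ x hx, hsq, ← eP x hx]
      ring
    · rw [e₂ 0 hmem0, v0, neg_zero]
    · rw [e₂ L hmemL, vL, neg_zero]
  have hw0 : ∀ x ∈ Icc 0 L, 0 ≤ w x := fun x hx => neg_nonpos.1 <|
    nonpos_of_mul_le_deriv2 (f := fun x => -w x) le_rfl (by fun_prop) (fun x _ => (hw x).fun_neg)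
      (fun x _ => (hw₁ x).fun_neg)
      (fun x hx => by simpa using (hvb x (Ioo_subset_Icc_self hx)).1)
      (by simp [w0]) (by simp [wL]) x hx
  have hw1 : ∀ x ∈ Icc 0 L, w x ≤ lam * sin (π * x / L) := fun x hx => sub_nonpos.1 <|
    nonpos_of_mul_le_deriv2 (f := fun x => w x - lam * sin (π * x / L)) le_rfl (by fun_prop)
      (fun x _ => (hw x).fun_sub ((hasDerivAt_sin_pi_mul_div L x).const_mul lam))
      (fun x _ => (hw₁ x).fun_sub
        (((hasDerivAt_cos_pi_mul_div L x).const_mul (π / L)).const_mul lam))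
      (fun x hx => by
        have := (hvb x (Ioo_subset_Icc_self hx)).2
        rw [zero_mul]
        refine (sub_nonneg.2 this).trans_eq ?_
        ring)
      (by simp [w0]) (by simp [wL, hL.ne']) x hx
  have hw2 : ∀ x ∈ Icc 0 L, iteratedDerivWithin 2 w (Icc 0 L) x ≤ 0 ∧
      -(lam * (π ^ 2 / L ^ 2) * sin (π * x / L)) ≤ iteratedDerivWithin 2 w (Icc 0 L) x :=
    fun x hx => by
      rw [e₂ x hx]
      exact ⟨neg_nonpos.2 (hvb x hx).1, neg_le_neg (hvb x hx).2⟩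
  refine ⟨w, ⟨hsol, fun x hx => ⟨hw0 x hx, hw1 x hx⟩, hw2, ?_⟩, fun w' ⟨h, h01, h2⟩ =>
    h.eq_of_concave hL ha hb hc hsol (fun x hx => (h01 x hx).1) hw0 (fun x hx => (h2 x hx).1)
      fun x hx => (hw2 x hx).1⟩
  refine (pos_or_eq_zero_of_deriv2_nonpos hw hw₁
    (fun x hx => neg_nonpos.2 (hvb x hx).1) hw0).resolve_right fun hz => ?_
  have z₀ : ∀ x ∈ Ioo 0 L, w x = 0 := fun x hx => hz x (Ioo_subset_Icc_self hx)
  have z₁ : ∀ x ∈ Ioo 0 L, w₁ x = 0 := fun x hx => (hw x).eq_zero_of_eqOn_zero z₀ hx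
  have z₂ : ∀ x ∈ Ioo 0 L, v x = 0 := fun x hx =>
    neg_eq_zero.1 ((hw₁ x).eq_zero_of_eqOn_zero z₁ hx)
  have z₃ : ∀ x ∈ Ioo 0 L, v₁ x = 0 := fun x hx => (hv x).eq_zero_of_eqOn_zero z₂ hx
  have hU0 : U = 0 := by
    rw [← hwU, intervalIntegral.integral_congr (g := fun _ => 0) fun x hx =>
      hz x (uIcc_of_le hL.le ▸ hx)]
    simp
  have z₄ : EqOn P (fun _ => 0) (Ioo 0 L) := fun x hx => by
    have := (hv₁ x).eq_zero_of_eqOn_zero z₃ hx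
    rw [z₂ x hx, hU0] at this
    simpa using this
  obtain ⟨x, hx, hpx⟩ := hpne
  have := z₄.closure cP continuous_const
  rw [closure_Ioo hL.ne] at this
  exact hpx ((eP x hx).symm.trans (this hx))
end

section
/- The function y(x) = −(15·sinh(2)/(6·(cosh(2)−1) − sinh(2))) · [ (2x − x²)/2 + (sinh(x) + sinh(2−x) − sinh(2))/sinh(2) ] satisfies y''''(x) − y''(x) + ∫₀² y(t)dt = −5 for all x ∈ (0,2), together with the boundary conditions y(0) = y(2) = y''(0) = y''(2) = 0; moreover y(x) ≤ 0 for all x ∈ [0,2]. -/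
open Real

/-- The profile `(2x - x²)/2 + (sinh x + sinh (2 - x) - sinh 2)/sinh 2`. -/
noncomputable def beamProfile (x : ℝ) : ℝ :=
  (2 * x - x ^ 2) / 2 + (Real.sinh x + Real.sinh (2 - x) - Real.sinh 2) / Real.sinh 2

lemma sinh_two_pos : 0 < Real.sinh 2 := Real.sinh_pos_iff.2 two_pos

lemma sinh_two_lt_six_mul_cosh_two_sub_one : Real.sinh 2 < 6 * (Real.cosh 2 - 1) := by
  have h1 : (1 : ℝ) < Real.sinh 1 := Real.self_lt_sinh_iff.2 one_pos
  have hs : Real.sinh 2 = 2 * Real.sinh 1 * Real.cosh 1 := by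
    rw [← Real.sinh_two_mul]; norm_num
  have hc : Real.cosh 2 = Real.cosh 1 ^ 2 + Real.sinh 1 ^ 2 := by
    rw [← Real.cosh_two_mul]; norm_num
  have hcs := Real.cosh_sq 1
  have hlt : Real.cosh 1 < 2 * Real.sinh 1 := by
    nlinarith [Real.cosh_pos 1]
  nlinarith

lemma hasDerivAt_sinh_two_sub (x : ℝ) :
    HasDerivAt (fun x => Real.sinh (2 - x)) (-Real.cosh (2 - x)) x := by
  simpa using ((hasDerivAt_id x).const_sub 2).sinh

lemma hasDerivAt_cosh_two_sub (x : ℝ) :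
    HasDerivAt (fun x => Real.cosh (2 - x)) (-Real.sinh (2 - x)) x := by
  simpa using ((hasDerivAt_id x).const_sub 2).cosh

lemma hasDerivAt_beamProfile (x : ℝ) :
    HasDerivAt beamProfile
      (1 - x + (Real.cosh x - Real.cosh (2 - x)) / Real.sinh 2) x := by
  have hpoly : HasDerivAt (fun x : ℝ => (2 * x - x ^ 2) / 2) ((2 * 1 - 2 * x) / 2) x := by
    simpa using (((hasDerivAt_id x).const_mul 2).sub ((hasDerivAt_id x).pow 2)).div_const 2
  refine (hpoly.add ((((Real.hasDerivAt_sinh x).add (hasDerivAt_sinh_two_sub x)).sub_const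
    (Real.sinh 2)).div_const (Real.sinh 2))).congr_deriv ?_
  ring

lemma hasDerivAt_deriv_beamProfile (x : ℝ) :
    HasDerivAt (fun x => 1 - x + (Real.cosh x - Real.cosh (2 - x)) / Real.sinh 2)
      (-1 + (Real.sinh x + Real.sinh (2 - x)) / Real.sinh 2) x := by
  refine (((hasDerivAt_id x).const_sub 1).add (((Real.hasDerivAt_cosh x).sub
    (hasDerivAt_cosh_two_sub x)).div_const (Real.sinh 2))).congr_deriv ?_
  ring

lemma iteratedDeriv_two_beamProfile :
    iteratedDeriv 2 beamProfile =
      fun x => -1 + (Real.sinh x + Real.sinh (2 - x)) / Real.sinh 2 := by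
  rw [iteratedDeriv_succ, iteratedDeriv_one, funext fun x => (hasDerivAt_beamProfile x).deriv]
  exact funext fun x => (hasDerivAt_deriv_beamProfile x).deriv

lemma iteratedDeriv_four_beamProfile :
    iteratedDeriv 4 beamProfile =
      fun x => (Real.sinh x + Real.sinh (2 - x)) / Real.sinh 2 := by
  have h3 (x : ℝ) : HasDerivAt (fun x => -1 + (Real.sinh x + Real.sinh (2 - x)) / Real.sinh 2)
      ((Real.cosh x - Real.cosh (2 - x)) / Real.sinh 2) x := by
    refine ((((Real.hasDerivAt_sinh x).add (hasDerivAt_sinh_two_sub x)).div_const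
      (Real.sinh 2)).const_add (-1)).congr_deriv ?_
    ring
  have h4 (x : ℝ) : HasDerivAt (fun x => (Real.cosh x - Real.cosh (2 - x)) / Real.sinh 2)
      ((Real.sinh x + Real.sinh (2 - x)) / Real.sinh 2) x := by
    refine (((Real.hasDerivAt_cosh x).sub (hasDerivAt_cosh_two_sub x)).div_const
      (Real.sinh 2)).congr_deriv ?_
    ring
  rw [iteratedDeriv_succ, iteratedDeriv_succ, iteratedDeriv_two_beamProfile,
    funext fun x => (h3 x).deriv]
  exact funext fun x => (h4 x).deriv

lemma integral_beamProfile :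
    ∫ t in (0 : ℝ)..2, beamProfile t = -4 / 3 + 2 * (Real.cosh 2 - 1) / Real.sinh 2 := by
  have hS := sinh_two_pos.ne'
  have hprim (x : ℝ) : HasDerivAt (fun x : ℝ => (x ^ 2 - x ^ 3 / 3) / 2 +
      (Real.cosh x - Real.cosh (2 - x) - Real.sinh 2 * x) / Real.sinh 2) (beamProfile x) x := by
    have hpoly := ((hasDerivAt_pow 2 x).sub ((hasDerivAt_pow 3 x).div_const 3)).div_const 2
    refine (hpoly.add ((((Real.hasDerivAt_cosh x).sub (hasDerivAt_cosh_two_sub x)).sub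
      ((hasDerivAt_id x).const_mul (Real.sinh 2))).div_const (Real.sinh 2))).congr_deriv ?_
    simp only [beamProfile]
    push_cast
    ring
  have hcont : Continuous beamProfile :=
    continuous_iff_continuousAt.2 fun x => (hasDerivAt_beamProfile x).continuousAt
  rw [intervalIntegral.integral_eq_sub_of_hasDerivAt (fun x _ => hprim x)
    (hcont.intervalIntegrable 0 2)]
  norm_num
  field_simp
  ring

lemma sinh_add_sinh_two_sub_le {x : ℝ} (hx : x ∈ Set.Icc (0 : ℝ) 2) :
    Real.sinh x + Real.sinh (2 - x) ≤ Real.sinh 2 := by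
  have hsum : Real.sinh x + Real.sinh (2 - x) = 2 * Real.sinh 1 * Real.cosh (x - 1) := by
    have ha : Real.sinh x = Real.sinh 1 * Real.cosh (x - 1) + Real.cosh 1 * Real.sinh (x - 1) := by
      rw [← Real.sinh_add]; ring_nf
    have hb : Real.sinh (2 - x) =
        Real.sinh 1 * Real.cosh (x - 1) - Real.cosh 1 * Real.sinh (x - 1) := by
      rw [← Real.sinh_sub]; ring_nf
    linarith
  have hs : Real.sinh 2 = 2 * Real.sinh 1 * Real.cosh 1 := by
    rw [← Real.sinh_two_mul]; norm_num
  rw [hsum, hs]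
  have h1 : 0 < Real.sinh 1 := Real.sinh_pos_iff.2 one_pos
  have hle : Real.cosh (x - 1) ≤ Real.cosh 1 := by
    rw [Real.cosh_le_cosh, abs_one, abs_le]
    constructor <;> linarith [hx.1, hx.2]
  gcongr

lemma beamProfile_zero : beamProfile 0 = 0 := by simp [beamProfile]

lemma beamProfile_two : beamProfile 2 = 0 := by norm_num [beamProfile]

lemma beamProfile_nonneg {x : ℝ} (hx : x ∈ Set.Icc (0 : ℝ) 2) : 0 ≤ beamProfile x := by
  have hconc : ConcaveOn ℝ (Set.Icc (0 : ℝ) 2) beamProfile := by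
    refine concaveOn_of_hasDerivWithinAt2_nonpos (convex_Icc 0 2)
      (fun x _ => (hasDerivAt_beamProfile x).continuousAt.continuousWithinAt)
      (fun x _ => (hasDerivAt_beamProfile x).hasDerivWithinAt)
      (fun x _ => (hasDerivAt_deriv_beamProfile x).hasDerivWithinAt) fun x hx => ?_
    have := (div_le_one sinh_two_pos).2 (sinh_add_sinh_two_sub_le (interior_subset hx))
    linarith
  simpa [beamProfile_zero, beamProfile_two] using
    hconc.min_le_of_mem_Icc (Set.left_mem_Icc.2 two_pos.le) (Set.right_mem_Icc.2 two_pos.le) hx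

theorem stmt19 (y : ℝ → ℝ)
    (hy : ∀ x, y x = -(15 * Real.sinh 2 / (6 * (Real.cosh 2 - 1) - Real.sinh 2))
      * ((2 * x - x ^ 2) / 2
          + (Real.sinh x + Real.sinh (2 - x) - Real.sinh 2) / Real.sinh 2)) :
    (∀ x ∈ Set.Ioo (0:ℝ) 2,
      iteratedDeriv 4 y x - iteratedDeriv 2 y x + ∫ t in (0:ℝ)..2, y t = -5) ∧
    y 0 = 0 ∧ y 2 = 0 ∧ iteratedDeriv 2 y 0 = 0 ∧ iteratedDeriv 2 y 2 = 0 ∧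
    ∀ x ∈ Set.Icc (0:ℝ) 2, y x ≤ 0 := by
  have hS := sinh_two_pos
  have hD : 0 < 6 * (Real.cosh 2 - 1) - Real.sinh 2 :=
    sub_pos.2 sinh_two_lt_six_mul_cosh_two_sub_one
  obtain ⟨K, hK⟩ : ∃ K, K = 15 * Real.sinh 2 / (6 * (Real.cosh 2 - 1) - Real.sinh 2) := ⟨_, rfl⟩
  have hK0 : 0 ≤ K := by rw [hK]; positivity
  obtain rfl : y = fun x => -K * beamProfile x := funext fun x => by rw [hy x, hK, beamProfile]
  have hiter (n : ℕ) (x : ℝ) : iteratedDeriv n (fun x => -K * beamProfile x) x =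
      -K * iteratedDeriv n beamProfile x := iteratedDeriv_const_mul_field _ _
  refine ⟨fun x _ => ?_, ?_, ?_, ?_, ?_, fun x hx => ?_⟩
  · rw [hiter, hiter, iteratedDeriv_two_beamProfile, iteratedDeriv_four_beamProfile,
      intervalIntegral.integral_const_mul, integral_beamProfile, hK]
    have := hS.ne'
    have := hD.ne'
    field_simp
    ring
  · simp [beamProfile_zero]
  · simp [beamProfile_two]
  · simp [iteratedDeriv_two_beamProfile, hS.ne']
  · simp [iteratedDeriv_two_beamProfile, hS.ne']
  · nlinarith [beamProfile_nonneg hx]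
end
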